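/- Let I be a set and for every ι ∈ I let A_ι ⊆ D_ι be a unital inclusion of unital C*-algebras. Suppose φ_ι is a state on D_ι such that the GNS representations of φ_ι and of the restriction φ_ι|_{A_ι} are both faithful. Let (D,φ) = *_{ι∈I}(D_ι,φ_ι) and (A,ψ) = *_{ι∈I}(A_ι,φ_ι|_{A_ι}) be the reduced free products of C*-algebras. Then there is a *-homomorphism π : A → D, necessarily injective, such that for every ι ∈ I the restriction of π to the canonical copy of A_ι in A agrees with the composition of the inclusion A_ι ⊆ D_ι with the canonical embedding D_ι ↪ D. -/

import Mathlib

noncomputable section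

/-- A conditional expectation from a unital C⋆-algebra `A` onto a unital C⋆-subalgebra
(the range of the unital embedding `j : B →⋆ₐ[ℂ] A`): a positive, `B`–`B`-bimodule,
idempotent (i.e. restricting to the identity on `B`) contraction. -/
structure IsCondExp {B A : Type*} [CStarAlgebra B] [CStarAlgebra A]
    (j : B →⋆ₐ[ℂ] A) (E : A →ₗ[ℂ] B) : Prop where
  injective : Function.Injective j
  left_inverse : ∀ b : B, E (j b) = b
  bimodule : ∀ (b₁ b₂ : B) (a : A), E (j b₁ * a * j b₂) = b₁ * E a * b₂
  positive : ∀ a : A, ∃ b : B, E (star a * a) = star b * b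
  contractive : ∀ a : A, ‖E a‖ ≤ ‖a‖

/-- The GNS representation of a conditional expectation `E : A → B` (i.e. the left action
of `A` on the Hilbert `B`-module `L²(A,E)` obtained from `A` by separation and completion
with respect to the `B`-valued inner product `⟨a₁, a₂⟩ = E (a₁⋆ * a₂)`) is faithful:
`a` acts as zero on the image of `A` in `L²(A,E)` only if `a = 0`. -/
def FaithfulGNS {B A : Type*} [CStarAlgebra B] [CStarAlgebra A] (E : A →ₗ[ℂ] B) : Prop :=
  ∀ a : A, (∀ x : A, E (star (a * x) * (a * x)) = 0) → a = 0

/-- `(C, jC, emb, E)` is the reduced amalgamated free product of the unital C⋆-algebras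
`A i` over `B` with respect to the conditional expectations `φ i : A i → B` (each having
faithful GNS representation): the `A i` embed into `C` compatibly with the copies of `B`,
`E` is a conditional expectation onto `B` with faithful GNS representation restricting to
`φ i` on each `A i`, the family of copies of the `A i` is free with respect to `E`, and
the copies of the `A i` together generate `C` as a C⋆-algebra.  These properties
characterize the reduced amalgamated free product `(A,φ) = (*_B)_{i ∈ I} (A i, φ i)`
up to canonical isomorphism. -/
structure IsReducedAmalgProd (B : Type*) [CStarAlgebra B] {I : Type*} {A : I → Type*}
    [∀ i, CStarAlgebra (A i)] (jB : ∀ i, B →⋆ₐ[ℂ] A i) (φ : ∀ i, A i →ₗ[ℂ] B)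
    {C : Type*} [CStarAlgebra C] (jC : B →⋆ₐ[ℂ] C) (emb : ∀ i, A i →⋆ₐ[ℂ] C)
    (E : C →ₗ[ℂ] B) : Prop where
  emb_injective : ∀ i, Function.Injective (emb i)
  compat : ∀ i, (emb i).comp (jB i) = jC
  condExp : IsCondExp jC E
  restrict : ∀ i (a : A i), E (emb i a) = φ i a
  faithful : FaithfulGNS E
  free : ∀ (n : ℕ) (ι : Fin (n + 1) → I), (∀ k : Fin n, ι k.castSucc ≠ ι k.succ) →
    ∀ a : (j : Fin (n + 1)) → A (ι j), (∀ j, φ (ι j) (a j) = 0) →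
      E ((List.ofFn fun j => emb (ι j) (a j)).prod) = 0
  generating :
    Dense ((StarAlgebra.adjoin ℂ (⋃ i, Set.range (emb i)) : StarSubalgebra ℂ C) : Set C)

/-- A state on a unital C⋆-algebra `D`, viewed as a conditional expectation onto the
canonical copy of `ℂ` in `D`; in particular it is unital, positive and contractive. -/
def IsState {D : Type*} [CStarAlgebra D] (φ : D →ₗ[ℂ] ℂ) : Prop :=
  IsCondExp (StarAlgHom.ofId ℂ D) φ

section Words

variable {I : Type*} {A : I → Type*}

/-- The first letter of the word, if any, does not come from `A i`. -/
def NotStartsIn (i : I) (l : List (Σ i, A i)) : Prop :=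
  ∀ s ∈ l.head?, i ≠ s.1

lemma notStartsIn_nil (i : I) : NotStartsIn i ([] : List (Σ i, A i)) := by
  simp [NotStartsIn]

variable [∀ i, CStarAlgebra (A i)]

/-- Lists of letters in which neighbours come from different algebras and every letter is
centred with respect to `φ`. -/
def IsReducedWord (φ : ∀ i, A i →ₗ[ℂ] ℂ) (l : List (Σ i, A i)) : Prop :=
  l.IsChain (fun s t => s.1 ≠ t.1) ∧ ∀ s ∈ l, φ s.1 s.2 = 0

/-- The product in `C` of the letters of a word. -/
def wordProd {C : Type*} [CStarAlgebra C] (emb : ∀ i, A i →⋆ₐ[ℂ] C)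
    (l : List (Σ i, A i)) : C :=
  (l.map fun s => emb s.1 s.2).prod

variable {φ : ∀ i, A i →ₗ[ℂ] ℂ} {C : Type*} [CStarAlgebra C] {emb : ∀ i, A i →⋆ₐ[ℂ] C}
  {E : C →ₗ[ℂ] ℂ}

@[simp]
lemma wordProd_nil : wordProd emb [] = 1 := rfl

@[simp]
lemma wordProd_cons (s : Σ i, A i) (l : List (Σ i, A i)) :
    wordProd emb (s :: l) = emb s.1 s.2 * wordProd emb l := by
  simp [wordProd]

@[simp]
lemma wordProd_append (l m : List (Σ i, A i)) :
    wordProd emb (l ++ m) = wordProd emb l * wordProd emb m := by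
  simp [wordProd]

lemma isReducedWord_nil : IsReducedWord φ [] := by
  simp [IsReducedWord]

lemma isReducedWord_cons {i : I} {a : A i} {l : List (Σ i, A i)} :
    IsReducedWord φ (⟨i, a⟩ :: l) ↔ φ i a = 0 ∧ NotStartsIn i l ∧ IsReducedWord φ l := by
  simp only [IsReducedWord, NotStartsIn, List.isChain_cons, List.forall_mem_cons]
  tauto

lemma IsReducedWord.reverse {l : List (Σ i, A i)} (h : IsReducedWord φ l) :
    IsReducedWord φ l.reverse := by
  refine ⟨List.isChain_reverse.2 (h.1.imp fun _ _ hab => hab.symm), fun s hs => ?_⟩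
  exact h.2 s (List.mem_reverse.1 hs)

lemma IsReducedWord.reverse_append_cons {i : I} {z : A i} {u v : List (Σ i, A i)}
    (hu : IsReducedWord φ u) (hv : IsReducedWord φ v) (hui : NotStartsIn i u)
    (hvi : NotStartsIn i v) (hz : φ i z = 0) :
    IsReducedWord φ (u.reverse ++ ⟨i, z⟩ :: v) := by
  have hc := isReducedWord_cons.2 ⟨hz, hvi, hv⟩
  refine ⟨List.isChain_append.2 ⟨hu.reverse.1, hc.1, ?_⟩, fun s hs => ?_⟩
  · intro x hx y hy
    rw [List.getLast?_reverse] at hx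
    simp only [List.head?_cons, Option.mem_def, Option.some.injEq] at hy
    subst hy
    exact (hui x hx).symm
  · rcases List.mem_append.1 hs with h | h
    · exact hu.reverse.2 s h
    · exact hc.2 s h

/-- The copies of the `A i` in `C` are free with respect to the unital functional `E`, which
restricts to functionals with the same centred elements as `φ`. -/
structure IsFreeFamily (φ : ∀ i, A i →ₗ[ℂ] ℂ) (emb : ∀ i, A i →⋆ₐ[ℂ] C)
    (E : C →ₗ[ℂ] ℂ) : Prop where
  map_one : E 1 = 1
  unital : ∀ i, φ i 1 = 1
  wordProd_eq_zero : ∀ l, IsReducedWord φ l → l ≠ [] → E (wordProd emb l) = 0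

lemma exists_scalar_add_centered (hφ : ∀ i, φ i 1 = 1) {i : I} (z : A i) :
    ∃ z₀ : A i, φ i z₀ = 0 ∧ z = φ i z • (1 : A i) + z₀ :=
  ⟨z - φ i z • 1, by simp [hφ], by simp⟩

namespace IsFreeFamily

lemma map_reverse_mul_mul (h : IsFreeFamily φ emb E) {i : I} (z : A i) {u v : List (Σ i, A i)}
    (hu : IsReducedWord φ u) (hv : IsReducedWord φ v) (hui : NotStartsIn i u)
    (hvi : NotStartsIn i v) :
    E (wordProd emb u.reverse * emb i z * wordProd emb v) =
      φ i z * E (wordProd emb u.reverse * wordProd emb v) := by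
  obtain ⟨z₀, hz₀, hz⟩ := exists_scalar_add_centered h.unital z
  have h0 := h.wordProd_eq_zero _ (hu.reverse_append_cons hv hui hvi hz₀) (by simp)
  simp only [wordProd_append, wordProd_cons, ← mul_assoc] at h0
  conv_lhs => rw [hz]
  simp [mul_add, add_mul, h0]

/-- Reduced words of different lengths are orthogonal. -/
lemma map_reverse_mul_eq_zero (h : IsFreeFamily φ emb E) {u v : List (Σ i, A i)}
    (hu : IsReducedWord φ u) (hv : IsReducedWord φ v) (huv : u.length ≠ v.length) :
    E (wordProd emb u.reverse * wordProd emb v) = 0 := by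
  induction u generalizing v with
  | nil =>
    have : v ≠ [] := by rintro rfl; simp at huv
    simpa using h.wordProd_eq_zero v hv this
  | cons s u ih =>
    obtain ⟨i, x⟩ := s
    cases v with
    | nil => simpa using h.wordProd_eq_zero _ hu.reverse (by simp)
    | cons t v =>
      obtain ⟨j, y⟩ := t
      have hu' := isReducedWord_cons.1 hu
      have hv' := isReducedWord_cons.1 hv
      by_cases hij : i = j
      · subst hij
        have := h.map_reverse_mul_mul (x * y) hu'.2.2 hv'.2.2 hu'.2.1 hv'.2.1
        rw [ih hu'.2.2 hv'.2.2 (by simpa using huv), mul_zero] at this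
        simpa [mul_assoc] using this
      · have hw : IsReducedWord φ (u.reverse ++ ⟨i, x⟩ :: ⟨j, y⟩ :: v) :=
          hu'.2.2.reverse_append_cons hv hu'.2.1 (by simpa [NotStartsIn] using hij) hu'.1
        have := h.wordProd_eq_zero _ hw (by simp)
        simpa [mul_assoc] using this

lemma map_reverse_mul_mul_mul_mul (h : IsFreeFamily φ emb E) {i : I} (x y : A i)
    {u m w : List (Σ i, A i)} (hu : IsReducedWord φ u) (hui : NotStartsIn i u)
    (hw : IsReducedWord φ w) (hwi : NotStartsIn i w) (hm : IsReducedWord φ m) (hmi : NotStartsIn i m)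
    (hmi' : NotStartsIn i m.reverse) (hmne : m ≠ []) (huw : u.length = w.length) :
    E (wordProd emb u.reverse * emb i x * wordProd emb m * emb i y * wordProd emb w) =
      φ i x * φ i y * E (wordProd emb u.reverse * wordProd emb m * wordProd emb w) := by
  obtain ⟨x₀, hx₀, hx⟩ := exists_scalar_add_centered h.unital x
  obtain ⟨y₀, hy₀, hy⟩ := exists_scalar_add_centered h.unital y
  have hmyw := hm.reverse.reverse_append_cons hw hmi' hwi hy₀
  have hmxu := hm.reverse_append_cons hu hmi hui hx₀
  rw [List.reverse_reverse] at hmyw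
  have h1 := h.map_reverse_mul_eq_zero hu hmyw (by simp; omega)
  have h2 := h.map_reverse_mul_eq_zero hmxu hw (by simp; omega)
  have h3 : E (wordProd emb u.reverse * emb i x₀ * wordProd emb m * emb i y₀ *
      wordProd emb w) = 0 := by
    have hstart : NotStartsIn i (m ++ ⟨i, y₀⟩ :: w) := by
      cases m with
      | nil => exact absurd rfl hmne
      | cons s m => simpa [NotStartsIn] using hmi
    have := h.wordProd_eq_zero _ (hu.reverse_append_cons hmyw hui hstart hx₀) (by simp)
    simpa [mul_assoc] using this
  simp only [wordProd_append, wordProd_cons, List.reverse_append, List.reverse_cons,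
    List.reverse_reverse, wordProd_nil, mul_one, ← mul_assoc] at h1 h2
  conv_lhs => rw [hx, hy]
  simp [mul_add, add_mul, h1, h2, h3]
  ring

end IsFreeFamily

/-- The elements of `C` obtained from nonempty reduced words neither starting nor ending in
`A i` by multiplying from both sides with elements of `A i`. -/
def offWords (φ : ∀ i, A i →ₗ[ℂ] ℂ) (emb : ∀ i, A i →⋆ₐ[ℂ] C) (i : I) : Set C :=
  {x | ∃ (a b : A i) (m : List (Σ i, A i)), IsReducedWord φ m ∧ m ≠ [] ∧ NotStartsIn i m ∧
    NotStartsIn i m.reverse ∧ x = emb i a * wordProd emb m * emb i b}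

lemma IsReducedWord.exists_trim_left {l : List (Σ i, A i)} (hl : IsReducedWord φ l) (i : I) :
    ∃ (a : A i) (m : List (Σ i, A i)), IsReducedWord φ m ∧ NotStartsIn i m ∧
      wordProd emb l = emb i a * wordProd emb m := by
  cases l with
  | nil => exact ⟨1, [], isReducedWord_nil, notStartsIn_nil i, by simp⟩
  | cons s l =>
    obtain ⟨j, x⟩ := s
    by_cases hij : i = j
    · subst hij
      have hl' := isReducedWord_cons.1 hl
      exact ⟨x, l, hl'.2.2, hl'.2.1, by simp⟩
    · exact ⟨1, _, hl, by simpa [NotStartsIn] using hij, by simp⟩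

lemma IsReducedWord.exists_trim_right {l : List (Σ i, A i)} (hl : IsReducedWord φ l) (i : I)
    (hli : NotStartsIn i l) :
    ∃ (a : A i) (m : List (Σ i, A i)), IsReducedWord φ m ∧ NotStartsIn i m ∧
      NotStartsIn i m.reverse ∧ wordProd emb l = wordProd emb m * emb i a := by
  rcases List.eq_nil_or_concat l with rfl | ⟨m, ⟨j, x⟩, rfl⟩
  · exact ⟨1, [], isReducedWord_nil, notStartsIn_nil i, notStartsIn_nil i, by simp⟩
  · by_cases hij : i = j
    · subst hij
      have hl' := hl.reverse
      simp only [List.concat_eq_append, List.reverse_append, List.reverse_cons,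
        List.reverse_nil, List.nil_append, List.singleton_append] at hl'
      have hl'' := isReducedWord_cons.1 hl'
      refine ⟨x, m, by simpa using hl''.2.2.reverse, ?_, hl''.2.1, by simp⟩
      cases m with
      | nil => exact notStartsIn_nil i
      | cons s m => simpa [NotStartsIn] using hli
    · exact ⟨1, _, hl, hli, by simpa [NotStartsIn] using hij, by simp⟩

lemma span_wordProd_le (i : I) :
    Submodule.span ℂ {x | ∃ l, IsReducedWord φ l ∧ x = wordProd emb l} ≤
      LinearMap.range (emb i).toAlgHom.toLinearMap ⊔ Submodule.span ℂ (offWords φ emb i) := by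
  rw [Submodule.span_le]
  rintro _ ⟨l, hl, rfl⟩
  obtain ⟨a, l', hl', hli, hP⟩ := hl.exists_trim_left (emb := emb) i
  obtain ⟨b, m, hm, hmi, hmi', hP'⟩ := hl'.exists_trim_right (emb := emb) i hli
  rw [hP, hP']
  by_cases hnil : m = []
  · subst hnil
    exact Submodule.mem_sup_left ⟨a * b, by simp⟩
  · exact Submodule.mem_sup_right
      (Submodule.subset_span ⟨a, b, m, hm, hnil, hmi, hmi', (mul_assoc _ _ _).symm⟩)

/-- The algebra generated by the `A i` is spanned by the reduced words. -/
lemma adjoin_le_span_wordProd (hφ : ∀ i, φ i 1 = 1) {x : C}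
    (hx : x ∈ StarAlgebra.adjoin ℂ (⋃ i, Set.range (emb i))) :
    x ∈ Submodule.span ℂ {x | ∃ l, IsReducedWord φ l ∧ x = wordProd emb l} := by
  set S := Submodule.span ℂ {x | ∃ l, IsReducedWord φ l ∧ x = wordProd emb l}
  have hword : ∀ {l}, IsReducedWord φ l → wordProd emb l ∈ S :=
    fun hl => Submodule.subset_span ⟨_, hl, rfl⟩
  have hmul : ∀ i (a : A i), ∀ y ∈ S, emb i a * y ∈ S := by
    intro i a y hy
    induction hy using Submodule.span_induction with
    | zero => simp
    | add y z _ _ hy hz => rw [mul_add]; exact add_mem hy hz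
    | smul c y _ hy => rw [mul_smul_comm]; exact S.smul_mem c hy
    | mem y hy =>
      obtain ⟨l, hl, rfl⟩ := hy
      obtain ⟨b, m, hm, hmi, hP⟩ := hl.exists_trim_left (emb := emb) i
      obtain ⟨z, hz, hab⟩ := exists_scalar_add_centered hφ (a * b)
      have h1 := hword hm
      have h2 := hword (isReducedWord_cons.2 ⟨hz, hmi, hm⟩)
      rw [wordProd_cons] at h2
      rw [hP, ← mul_assoc, ← map_mul, hab, map_add, map_smul, map_one, add_mul, smul_mul_assoc,
        one_mul]
      exact add_mem (S.smul_mem _ h1) h2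
  have hadj : ∀ x ∈ Algebra.adjoin ℂ
      ((⋃ i, Set.range (emb i)) ∪ star (⋃ i, Set.range (emb i))), ∀ y ∈ S, x * y ∈ S := by
    intro x hx
    induction hx using Algebra.adjoin_induction with
    | mem x hx =>
      rcases hx with hx | hx
      · obtain ⟨i, a, rfl⟩ := Set.mem_iUnion.1 hx
        exact hmul i a
      · obtain ⟨i, a, ha⟩ := Set.mem_iUnion.1 (Set.mem_star.1 hx)
        rw [← star_star x, ← ha, ← map_star]
        exact hmul i (star a)
    | algebraMap c => intro y hy; rw [← Algebra.smul_def]; exact S.smul_mem c hy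
    | add x z _ _ hx hz => intro y hy; rw [add_mul]; exact add_mem (hx y hy) (hz y hy)
    | mul x z _ _ hx hz => intro y hy; rw [mul_assoc]; exact hx _ (hz y hy)
  rw [← StarSubalgebra.mem_toSubalgebra, StarAlgebra.adjoin_toSubalgebra] at hx
  simpa using hadj x hx 1 (by simpa using hword isReducedWord_nil)

end Words

section GNS

open scoped ComplexOrder

universe u

variable {C : Type*} [CStarAlgebra C] {E : C →ₗ[ℂ] ℂ}

/-- `ρ` is a representation of `C` on the Hilbert space `H` and `Λ : C → H` is an intertwining
map with dense range implementing the sesquilinear form `(x, y) ↦ E (x⋆ * y)`. -/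
structure IsGNSRep (E : C →ₗ[ℂ] ℂ) {H : Type*} [NormedAddCommGroup H] [InnerProductSpace ℂ H]
    [CompleteSpace H] (ρ : C →⋆ₐ[ℂ] (H →L[ℂ] H)) (Λ : C →ₗ[ℂ] H) : Prop where
  inner_eq : ∀ x y, inner ℂ (Λ x) (Λ y) = E (star x * y)
  apply_eq : ∀ x y, ρ x (Λ y) = Λ (x * y)
  denseRange : DenseRange Λ

theorem IsState.exists_isGNSRep {C : Type u} [CStarAlgebra C] {E : C →ₗ[ℂ] ℂ} (hE : IsState E) :
    ∃ (H : Type u) (_ : NormedAddCommGroup H) (_ : InnerProductSpace ℂ H) (_ : CompleteSpace H)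
      (ρ : C →⋆ₐ[ℂ] (H →L[ℂ] H)) (Λ : C →ₗ[ℂ] H), IsGNSRep E ρ Λ := by
  let _ : PartialOrder C := CStarAlgebra.spectralOrder C
  have _ : StarOrderedRing C := CStarAlgebra.spectralOrderedRing C
  let f : C →ₚ[ℂ] ℂ := PositiveLinearMap.mk₀ E fun x hx => by
    obtain ⟨y, rfl⟩ := CStarAlgebra.nonneg_iff_eq_star_mul_self.1 hx
    obtain ⟨b, hb⟩ := hE.positive y
    rw [hb]
    exact star_mul_self_nonneg b
  refine ⟨f.GNS, inferInstance, inferInstance, inferInstance, f.gnsStarAlgHom,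
    (UniformSpace.Completion.toComplₗᵢ (𝕜 := ℂ) (E := f.PreGNS)).toLinearMap ∘ₗ
      f.toPreGNS.toLinearMap, ?_, ?_, ?_⟩
  · intro x y
    simp only [LinearMap.comp_apply, LinearEquiv.coe_coe, LinearIsometry.coe_toLinearMap,
      UniformSpace.Completion.coe_toComplₗᵢ, UniformSpace.Completion.inner_coe]
    rfl
  · intro x y
    exact f.gnsNonUnitalStarAlgHom_apply_coe
  · exact (UniformSpace.Completion.denseRange_coe (α := f.PreGNS)).comp
      f.toPreGNS.surjective.denseRange (UniformSpace.Completion.continuous_coe _)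

lemma IsState.map_one (hE : IsState E) : E 1 = 1 := by
  simpa using hE.left_inverse 1

lemma IsState.continuous (hE : IsState E) : Continuous E :=
  AddMonoidHomClass.continuous_of_bound E 1 (by simpa using hE.contractive)

lemma IsState.comp (hE : IsState E) {B : Type*} [CStarAlgebra B] (f : B →⋆ₐ[ℂ] C) :
    IsState (E.comp f.toAlgHom.toLinearMap) := by
  have hl : ∀ b : ℂ, E (f (StarAlgHom.ofId ℂ B b)) = b := by
    intro b
    simpa [Algebra.algebraMap_eq_smul_one] using hE.left_inverse b
  have hb : ∀ (b : ℂ), f (StarAlgHom.ofId ℂ B b) = StarAlgHom.ofId ℂ C b := by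
    intro b
    simp [Algebra.algebraMap_eq_smul_one]
  exact
    { injective := Function.LeftInverse.injective (g := fun x => E (f x)) hl
      left_inverse := hl
      bimodule := fun b₁ b₂ a => by
        have := hE.bimodule b₁ b₂ (f a)
        rw [← hb, ← hb, ← map_mul, ← map_mul] at this
        exact this
      positive := fun a => by simpa [map_star] using hE.positive (f a)
      contractive := fun a => (hE.contractive (f a)).trans (NonUnitalStarAlgHom.norm_apply_le f a) }

lemma inner_starAlgHom_apply_left {H : Type*} [NormedAddCommGroup H] [InnerProductSpace ℂ H]
    [CompleteSpace H] (ρ : C →⋆ₐ[ℂ] (H →L[ℂ] H)) (x : C) (ξ η : H) :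
    inner ℂ (ρ x ξ) η = inner ℂ ξ (ρ (star x) η) := by
  rw [map_star, ContinuousLinearMap.star_eq_adjoint,
    ContinuousLinearMap.adjoint_inner_right]

namespace IsGNSRep

variable {H : Type*} [NormedAddCommGroup H] [InnerProductSpace ℂ H] [CompleteSpace H]
  {ρ : C →⋆ₐ[ℂ] (H →L[ℂ] H)} {Λ : C →ₗ[ℂ] H}

lemma norm_apply_le (h : IsGNSRep E ρ Λ) (x y : C) : ‖Λ (x * y)‖ ≤ ‖x‖ * ‖Λ y‖ := by
  rw [← h.apply_eq]
  exact (ρ x).le_of_opNorm_le (NonUnitalStarAlgHom.norm_apply_le ρ x) _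

lemma continuous (h : IsGNSRep E ρ Λ) : Continuous Λ :=
  AddMonoidHomClass.continuous_of_bound Λ ‖Λ 1‖ fun x => by
    simpa [mul_comm] using h.norm_apply_le x 1

lemma norm_sq_eq (h : IsGNSRep E ρ Λ) (x : C) : ((‖Λ x‖ ^ 2 : ℝ) : ℂ) = E (star x * x) := by
  rw [← h.inner_eq, inner_self_eq_norm_sq_to_K]
  simp

lemma apply_star (h : IsGNSRep E ρ Λ) (x : C) : E (star x) = star (E x) := by
  have h1 := h.inner_eq x 1
  have h2 := h.inner_eq 1 x
  rw [← inner_conj_symm, h2] at h1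
  simpa using h1.symm

lemma eq_zero_of_apply (h : IsGNSRep E ρ Λ) (hE : FaithfulGNS E) {x : C}
    (hx : ∀ y, ρ x (Λ y) = 0) : x = 0 := by
  refine hE x fun y => ?_
  rw [← h.norm_sq_eq, ← h.apply_eq, hx]
  simp

lemma norm_le (h : IsGNSRep E ρ Λ) (hE : FaithfulGNS E) {x : C} {K : ℝ} (hK : 0 ≤ K)
    (hx : ∀ y, ‖Λ (x * y)‖ ≤ K * ‖Λ y‖) : ‖x‖ ≤ K := by
  have hinj : Function.Injective ρ :=
    (injective_iff_map_eq_zero ρ).2 fun z hz => h.eq_zero_of_apply hE fun y => by simp [hz]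
  rw [← NonUnitalStarAlgHom.norm_map ρ hinj]
  refine ContinuousLinearMap.opNorm_le_bound _ hK fun ξ => ?_
  refine h.denseRange.induction_on (p := fun ξ => ‖ρ x ξ‖ ≤ K * ‖ξ‖) ξ ?_ fun y => ?_
  · exact isClosed_le (by fun_prop) (by fun_prop)
  · rw [h.apply_eq]; exact hx y

end IsGNSRep

lemma IsState.apply_star (hE : IsState E) (x : C) : E (star x) = star (E x) := by
  obtain ⟨H, _, _, _, ρ, Λ, h⟩ := hE.exists_isGNSRep
  exact h.apply_star x

end GNS

section LetterwiseMaps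

variable {I : Type*} {A B : I → Type*}

/-- Apply a family of maps to the letters of a word. -/
def mapLetters (f : ∀ i, A i → B i) (l : List (Σ i, A i)) : List (Σ i, B i) :=
  l.map (Sigma.map id f)

lemma mapLetters_reverse (f : ∀ i, A i → B i) (l : List (Σ i, A i)) :
    mapLetters f l.reverse = (mapLetters f l).reverse := by
  simp [mapLetters]

lemma NotStartsIn.mapLetters {i : I} {l : List (Σ i, A i)} (h : NotStartsIn i l)
    (f : ∀ i, A i → B i) : NotStartsIn i (mapLetters f l) := by
  cases l with
  | nil => exact notStartsIn_nil i
  | cons s l => simpa [NotStartsIn, _root_.mapLetters, Sigma.map] using h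

variable [∀ i, CStarAlgebra (A i)] [∀ i, CStarAlgebra (B i)]

lemma IsReducedWord.mapLetters {φ : ∀ i, A i →ₗ[ℂ] ℂ} {ψ : ∀ i, B i →ₗ[ℂ] ℂ}
    {l : List (Σ i, A i)} (h : IsReducedWord φ l) {f : ∀ i, A i → B i}
    (hf : ∀ i a, φ i a = 0 → ψ i (f i a) = 0) : IsReducedWord ψ (mapLetters f l) := by
  refine ⟨(List.isChain_map _).2 h.1, fun s hs => ?_⟩
  obtain ⟨t, ht, rfl⟩ := List.mem_map.1 hs
  exact hf _ _ (h.2 t ht)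

lemma wordProd_mapLetters {C : Type*} [CStarAlgebra C] (emb : ∀ i, B i →⋆ₐ[ℂ] C)
    (f : ∀ i, A i →⋆ₐ[ℂ] B i) (l : List (Σ i, A i)) :
    wordProd emb (mapLetters (fun i => f i) l) = wordProd (fun i => (emb i).comp (f i)) l := by
  simp only [wordProd, mapLetters, List.map_map]
  rfl

lemma star_wordProd {C : Type*} [CStarAlgebra C] (emb : ∀ i, A i →⋆ₐ[ℂ] C)
    (l : List (Σ i, A i)) :
    star (wordProd emb l) = wordProd emb (mapLetters (fun _ => star) l).reverse := by
  induction l with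
  | nil => simp [mapLetters]
  | cons s l ih =>
    rw [wordProd_cons, star_mul, ih, ← map_star]
    simp [mapLetters, Sigma.map]

lemma map_wordProd {C C' : Type*} [CStarAlgebra C] [CStarAlgebra C'] (f : C →⋆ₐ[ℂ] C')
    {emb : ∀ i, A i →⋆ₐ[ℂ] C} {emb' : ∀ i, A i →⋆ₐ[ℂ] C'}
    (hf : ∀ i a, f (emb i a) = emb' i a) (l : List (Σ i, A i)) :
    f (wordProd emb l) = wordProd emb' l := by
  induction l with
  | nil => simp
  | cons s l ih => simp [ih, hf]

lemma map_mem_span_offWords {C C' : Type*} [CStarAlgebra C] [CStarAlgebra C']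
    {φ : ∀ i, A i →ₗ[ℂ] ℂ} {emb : ∀ i, A i →⋆ₐ[ℂ] C} {emb' : ∀ i, A i →⋆ₐ[ℂ] C'} {i : I}
    (f : C →⋆ₐ[ℂ] C') (hf : ∀ i a, f (emb i a) = emb' i a) {r : C}
    (hr : r ∈ Submodule.span ℂ (offWords φ emb i)) :
    f r ∈ Submodule.span ℂ (offWords φ emb' i) := by
  induction hr using Submodule.span_induction with
  | zero => simp
  | add x y _ _ hx hy => rw [map_add]; exact add_mem hx hy
  | smul c x _ hx => rw [map_smul]; exact Submodule.smul_mem _ c hx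
  | mem x hx =>
    obtain ⟨a, b, m, hm, hne, hmi, hmi', rfl⟩ := hx
    exact Submodule.subset_span ⟨a, b, m, hm, hne, hmi, hmi', by simp [map_wordProd f hf, hf]⟩

end LetterwiseMaps

section Compression

variable {I : Type*} {A : I → Type*} [∀ i, CStarAlgebra (A i)] {φ : ∀ i, A i →ₗ[ℂ] ℂ}
  {C : Type*} [CStarAlgebra C] {emb : ∀ i, A i →⋆ₐ[ℂ] C} {E : C →ₗ[ℂ] ℂ}

lemma IsFreeFamily.map_mul_offWords_mul (h : IsFreeFamily φ emb E) {i : I} (x y : A i) {r : C}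
    (hr : r ∈ Submodule.span ℂ (offWords φ emb i)) : E (emb i x * r * emb i y) = 0 := by
  induction hr using Submodule.span_induction with
  | zero => simp
  | add r s _ _ hr hs => rw [mul_add, add_mul, map_add, hr, hs, add_zero]
  | smul c r _ hr => rw [mul_smul_comm, smul_mul_assoc, map_smul, hr, smul_zero]
  | mem r hr =>
    obtain ⟨a, b, m, hm, hne, hmi, hmi', rfl⟩ := hr
    have := h.map_reverse_mul_mul_mul_mul (x * a) (b * y) isReducedWord_nil (notStartsIn_nil i)
      isReducedWord_nil (notStartsIn_nil i) hm hmi hmi' hne rfl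
    simp only [List.reverse_nil, wordProd_nil, one_mul, mul_one, map_mul,
      h.wordProd_eq_zero m hm hne, mul_zero] at this
    rw [← this]
    simp only [mul_assoc]

/-- Compression to `A i` is contractive. -/
lemma IsFreeFamily.norm_le_norm_add (h : IsFreeFamily φ emb E) (hE : IsState E) {i : I}
    (hφ : IsState (φ i)) (hfaith : FaithfulGNS (φ i)) (hres : ∀ a, E (emb i a) = φ i a)
    (b : A i) {r : C} (hr : r ∈ Submodule.span ℂ (offWords φ emb i)) :
    ‖b‖ ≤ ‖emb i b + r‖ := by
  obtain ⟨H₀, _, _, _, ρ₀, Λ₀, h₀⟩ := hφ.exists_isGNSRep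
  obtain ⟨H, _, _, _, ρ, Λ, hΛ⟩ := hE.exists_isGNSRep
  have hnorm : ∀ x, ‖Λ (emb i x)‖ = ‖Λ₀ x‖ := by
    intro x
    have h1 := hΛ.norm_sq_eq (emb i x)
    rw [← map_star, ← map_mul, hres, ← h₀.norm_sq_eq] at h1
    exact (sq_eq_sq₀ (norm_nonneg _) (norm_nonneg _)).1 (by exact_mod_cast h1)
  refine h₀.norm_le hfaith (norm_nonneg _) fun y => ?_
  have key : ((‖Λ₀ (b * y)‖ ^ 2 : ℝ) : ℂ) =
      inner ℂ (Λ (emb i (b * y))) (Λ ((emb i b + r) * emb i y)) := by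
    rw [hΛ.inner_eq, h₀.norm_sq_eq, ← hres, add_mul, mul_add, map_add, ← mul_assoc _ r,
      ← map_star, h.map_mul_offWords_mul _ _ hr, add_zero, map_mul, map_mul (emb i) b]
  have hle : ‖Λ₀ (b * y)‖ ^ 2 ≤ ‖Λ₀ (b * y)‖ * (‖emb i b + r‖ * ‖Λ₀ y‖) := by
    calc ‖Λ₀ (b * y)‖ ^ 2 = ‖((‖Λ₀ (b * y)‖ ^ 2 : ℝ) : ℂ)‖ := by simp
      _ ≤ ‖Λ (emb i (b * y))‖ * ‖Λ ((emb i b + r) * emb i y)‖ := by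
        rw [key]; exact norm_inner_le_norm _ _
      _ ≤ _ := by
        rw [hnorm, ← hnorm y]
        gcongr
        exact hΛ.norm_apply_le _ _
  rcases (norm_nonneg (Λ₀ (b * y))).eq_or_lt with h0 | h0
  · rw [← h0]; positivity
  · rw [sq] at hle
    exact le_of_mul_le_mul_left hle h0

variable {D : I → Type*} [∀ i, CStarAlgebra (D i)] {ψ : ∀ i, D i →ₗ[ℂ] ℂ}
  {embD : ∀ i, D i →⋆ₐ[ℂ] C} {inc : ∀ i, A i →⋆ₐ[ℂ] D i}

/-- On vectors of `L²(D i) ⊗ w` orthogonal to `L²(A i) ⊗ w`, an alternating product of elements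
of the `A j` has vanishing diagonal matrix coefficients, unless it lies in `A i`. -/
lemma IsFreeFamily.inner_offWords_eq_zero {H : Type*} [NormedAddCommGroup H]
    [InnerProductSpace ℂ H] [CompleteSpace H] {ρ : C →⋆ₐ[ℂ] (H →L[ℂ] H)} {Λ : C →ₗ[ℂ] H}
    (h : IsFreeFamily ψ embD E) (hstar : ∀ i d, ψ i (star d) = star (ψ i d))
    (hΛ : IsGNSRep E ρ Λ) {i : I} {w : List (Σ i, D i)}
    (hw : IsReducedWord ψ w) (hwi : NotStartsIn i w) {v : H}
    (hv : v ∈ closure (Set.range fun d : D i => Λ (embD i d * wordProd embD w)))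
    (hvA : ∀ a : A i, inner ℂ (Λ (embD i (inc i a) * wordProd embD w)) v = 0) {r : C}
    (hr : r ∈ Submodule.span ℂ (offWords (fun i => (ψ i).comp (inc i).toAlgHom.toLinearMap)
      (fun i => (embD i).comp (inc i)) i)) :
    inner ℂ v (ρ r v) = 0 := by
  set W := wordProd embD w with hW
  set u := mapLetters (fun _ => star) w with hu_def
  have hWstar : star W = wordProd embD u.reverse := star_wordProd embD w
  have hu : IsReducedWord ψ u := hw.mapLetters fun i d hd => by rw [hstar, hd, star_zero]
  have hui : NotStartsIn i u := hwi.mapLetters _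
  have hinner : ∀ d d' : D i, inner ℂ (Λ (embD i d * W)) (Λ (embD i d' * W)) =
      ψ i (star d * d') * E (star W * W) := by
    intro d d'
    rw [hWstar, ← h.map_reverse_mul_mul _ hu hw hui hwi, hΛ.inner_eq, star_mul, hWstar,
      map_mul (embD i), map_star]
    simp only [mul_assoc, hW]
  by_cases hs : E (star W * W) = 0
  · have hzero : ∀ d, Λ (embD i d * W) = 0 := fun d => by
      rw [← inner_self_eq_zero (𝕜 := ℂ), hinner, hs, mul_zero]
    have : v = 0 := by simpa [hzero] using hv
    simp [this]
  induction hr using Submodule.span_induction with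
  | zero => simp
  | add r s _ _ hr hs => rw [map_add, add_apply, inner_add_right, hr, hs,
      add_zero]
  | smul c r _ hr => rw [map_smul, smul_apply, inner_smul_right, hr, mul_zero]
  | mem r hr =>
    obtain ⟨a, b, m, hm, hne, hmi, hmi', rfl⟩ := hr
    rw [← wordProd_mapLetters]
    set m' := mapLetters (fun i => inc i) m with hm'
    have hm : IsReducedWord ψ m' := hm.mapLetters fun i a ha => ha
    have hmi : NotStartsIn i m' := hmi.mapLetters _
    have hmi' : NotStartsIn i m'.reverse := by
      rw [hm', ← mapLetters_reverse]; exact hmi'.mapLetters _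
    have hne : m' ≠ [] := by simpa [hm', mapLetters] using hne
    set p := (embD i).comp (inc i) a * wordProd embD m' * (embD i).comp (inc i) b with hp
    set t := E (star W * wordProd embD m' * W) with ht
    have hform : ∀ ζ ∈ closure (Set.range fun d : D i => Λ (embD i d * W)),
        ∀ η ∈ closure (Set.range fun d : D i => Λ (embD i d * W)),
        E (star W * W) * E (star W * W) * inner ℂ ζ (ρ p η) =
          t * inner ℂ ζ (Λ (embD i (inc i a) * W)) *
            inner ℂ (Λ (embD i (inc i (star b)) * W)) η := by
      have hgen : ∀ d d' : D i,
          E (star W * W) * E (star W * W) * inner ℂ (Λ (embD i d * W)) (ρ p (Λ (embD i d' * W))) =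
          t * inner ℂ (Λ (embD i d * W)) (Λ (embD i (inc i a) * W)) *
            inner ℂ (Λ (embD i (inc i (star b)) * W)) (Λ (embD i d' * W)) := by
        intro d d'
        have hcalc := h.map_reverse_mul_mul_mul_mul (star d * inc i a) (inc i b * d') hu hui hw hwi
          hm hmi hmi' hne (by simp [hu_def, mapLetters])
        rw [← hWstar, ← hW, ← ht] at hcalc
        have : inner ℂ (Λ (embD i d * W)) (ρ p (Λ (embD i d' * W))) =
            ψ i (star d * inc i a) * ψ i (inc i b * d') * t := by
          rw [← hcalc, hΛ.apply_eq, hΛ.inner_eq, star_mul, hp]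
          simp only [map_mul, map_star, mul_assoc, StarAlgHom.comp_apply]
        rw [this, hinner, hinner, map_star, star_star]
        ring
      intro ζ hζ η hη
      refine closure_minimal (t := {ζ | E (star W * W) * E (star W * W) * inner ℂ ζ (ρ p η) =
          t * inner ℂ ζ (Λ (embD i (inc i a) * W)) *
            inner ℂ (Λ (embD i (inc i (star b)) * W)) η}) ?_
        (isClosed_eq (by fun_prop) (by fun_prop)) hζ
      rintro _ ⟨d, rfl⟩
      refine closure_minimal (t := {η | E (star W * W) * E (star W * W) *
          inner ℂ (Λ (embD i d * W)) (ρ p η) =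
          t * inner ℂ (Λ (embD i d * W)) (Λ (embD i (inc i a) * W)) *
            inner ℂ (Λ (embD i (inc i (star b)) * W)) η}) ?_
        (isClosed_eq (by fun_prop) (by fun_prop)) hη
      rintro _ ⟨d', rfl⟩
      exact hgen d d'
    have := hform v hv v hv
    rw [hvA, mul_zero] at this
    exact (mul_eq_zero.1 this).resolve_left (mul_ne_zero hs hs)

end Compression

section FreeProduct

variable {I : Type*} {A D : I → Type*} [∀ i, CStarAlgebra (A i)] [∀ i, CStarAlgebra (D i)]

lemma IsReducedAmalgProd.isFreeFamily {φ : ∀ i, A i →ₗ[ℂ] ℂ} {C : Type*} [CStarAlgebra C]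
    {emb : ∀ i, A i →⋆ₐ[ℂ] C} {E : C →ₗ[ℂ] ℂ}
    (h : IsReducedAmalgProd ℂ (fun i => StarAlgHom.ofId ℂ (A i)) φ (StarAlgHom.ofId ℂ C) emb E) :
    IsFreeFamily φ emb E where
  map_one := IsState.map_one h.condExp
  unital i := by rw [← h.restrict, map_one, IsState.map_one h.condExp]
  wordProd_eq_zero l hl hne := by
    obtain ⟨s, t, rfl⟩ := List.exists_cons_of_ne_nil hne
    have := h.free t.length (fun j => ((s :: t).get j).1)
      (fun k => List.isChain_iff_getElem.1 hl.1 k (by simp))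
      (fun j => ((s :: t).get j).2) fun j => hl.2 _ (List.get_mem _ _)
    rw [wordProd, ← this]
    congr 2
    conv_lhs => rw [← List.ofFn_get (s :: t), List.map_ofFn]
    rfl

variable {inc : ∀ i, A i →⋆ₐ[ℂ] D i} {φ : ∀ i, D i →ₗ[ℂ] ℂ}
  {CD : Type*} [CStarAlgebra CD] {embD : ∀ i, D i →⋆ₐ[ℂ] CD} {ED : CD →ₗ[ℂ] ℂ}
  {CA : Type*} [CStarAlgebra CA] {embA : ∀ i, A i →⋆ₐ[ℂ] CA} {EA : CA →ₗ[ℂ] ℂ}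

/-- The closed graph in `CA × CD` generated by the pairs consisting of an element of `A i` and
its image in `D i`. -/
def freeProdGraph (inc : ∀ i, A i →⋆ₐ[ℂ] D i) (embA : ∀ i, A i →⋆ₐ[ℂ] CA)
    (embD : ∀ i, D i →⋆ₐ[ℂ] CD) : StarSubalgebra ℂ (CA × CD) :=
  (StarAlgebra.adjoin ℂ
    (⋃ i, Set.range ((embA i).prod ((embD i).comp (inc i))))).topologicalClosure

lemma mem_freeProdGraph (i : I) (a : A i) :
    (embA i a, embD i (inc i a)) ∈ freeProdGraph inc embA embD :=
  StarSubalgebra.le_topologicalClosure _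
    (StarAlgebra.subset_adjoin ℂ _ (Set.mem_iUnion.2 ⟨i, a, rfl⟩))

lemma dense_fst_freeProdGraph
    (hgen : Dense ((StarAlgebra.adjoin ℂ (⋃ i, Set.range (embA i)) : StarSubalgebra ℂ CA) :
      Set CA)) : Dense {x | ∃ y, (x, y) ∈ freeProdGraph inc embA embD} := by
  have hle : StarAlgebra.adjoin ℂ (⋃ i, Set.range (embA i)) ≤
      (freeProdGraph inc embA embD).map (StarAlgHom.fst ℂ CA CD) := by
    refine StarAlgebra.adjoin_le (Set.iUnion_subset fun i => ?_)
    rintro _ ⟨a, rfl⟩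
    exact ⟨_, mem_freeProdGraph i a, rfl⟩
  refine hgen.mono fun x hx => ?_
  obtain ⟨p, hp, rfl⟩ := hle hx
  exact ⟨p.2, hp⟩

lemma IsFreeFamily.comp (h : IsFreeFamily φ embD ED) (inc : ∀ i, A i →⋆ₐ[ℂ] D i) :
    IsFreeFamily (fun i => (φ i).comp (inc i).toAlgHom.toLinearMap)
      (fun i => (embD i).comp (inc i)) ED where
  map_one := h.map_one
  unital i := by simpa using h.unital i
  wordProd_eq_zero l hl hne := by
    rw [← wordProd_mapLetters]
    exact h.wordProd_eq_zero _ (hl.mapLetters fun i a ha => ha) (by simpa [mapLetters] using hne)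

lemma apply_fst_eq_apply_snd
    (hA : IsFreeFamily (fun i => (φ i).comp (inc i).toAlgHom.toLinearMap) embA EA)
    (hD : IsFreeFamily φ embD ED) (hEA : Continuous EA) (hED : Continuous ED) {p : CA × CD}
    (hp : p ∈ freeProdGraph inc embA embD) : EA p.1 = ED p.2 := by
  refine closure_minimal (t := {p : CA × CD | EA p.1 = ED p.2}) (fun q hq => ?_)
    (isClosed_eq (by fun_prop) (by fun_prop)) hp
  have hspan := adjoin_le_span_wordProd hA.unital hq
  clear hq
  induction hspan using Submodule.span_induction with
  | zero => simp
  | add x y _ _ hx hy => simp_all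
  | smul c x _ hx => simp_all
  | mem x hx =>
    obtain ⟨l, hl, rfl⟩ := hx
    have h1 : (wordProd (fun i => (embA i).prod ((embD i).comp (inc i))) l).1 =
        wordProd embA l := map_wordProd (StarAlgHom.fst ℂ CA CD) (fun _ _ => rfl) l
    have h2 : (wordProd (fun i => (embA i).prod ((embD i).comp (inc i))) l).2 =
        wordProd (fun i => (embD i).comp (inc i)) l :=
      map_wordProd (StarAlgHom.snd ℂ CA CD) (fun _ _ => rfl) l
    rw [Set.mem_ofPred_eq, h1, h2]
    by_cases hne : l = []
    · subst hne
      rw [wordProd_nil, wordProd_nil, hA.map_one, hD.map_one]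
    · rw [hA.wordProd_eq_zero l hl hne, (hD.comp inc).wordProd_eq_zero l hl hne]

lemma eq_zero_of_mk_zero_mem
    (hA : IsFreeFamily (fun i => (φ i).comp (inc i).toAlgHom.toLinearMap) embA EA)
    (hD : IsFreeFamily φ embD ED) (hEA : IsState EA) (hED : IsState ED)
    (hfaith : FaithfulGNS EA)
    (hgen : Dense ((StarAlgebra.adjoin ℂ (⋃ i, Set.range (embA i)) : StarSubalgebra ℂ CA) :
      Set CA)) {x : CA} (hx : (x, 0) ∈ freeProdGraph inc embA embD) : x = 0 := by
  refine hfaith x fun z => ?_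
  have hcont := hEA.continuous
  refine closure_minimal (t := {z | EA (star (x * z) * (x * z)) = 0}) ?_
    (isClosed_eq (by fun_prop) (by fun_prop)) (dense_fst_freeProdGraph (inc := inc)
      (embD := embD) hgen z)
  rintro z ⟨y, hzy⟩
  have hmem := mul_mem hx hzy
  simpa using apply_fst_eq_apply_snd hA hD hEA.continuous hED.continuous
    (mul_mem (star_mem hmem) hmem)

lemma exists_add_offWords_near
    (hA : IsFreeFamily (fun i => (φ i).comp (inc i).toAlgHom.toLinearMap) embA EA)
    (hEA : IsState EA) {i : I} (hφ : IsState ((φ i).comp (inc i).toAlgHom.toLinearMap))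
    (hfaith : FaithfulGNS ((φ i).comp (inc i).toAlgHom.toLinearMap))
    (hres : ∀ a, EA (embA i a) = φ i (inc i a)) {y : CD}
    (hy : (0, y) ∈ freeProdGraph inc embA embD) {ε : ℝ} (hε : 0 < ε) :
    ∃ (b : A i) (r : CD), r ∈ Submodule.span ℂ
        (offWords (fun i => (φ i).comp (inc i).toAlgHom.toLinearMap)
          (fun i => (embD i).comp (inc i)) i) ∧
      ‖b‖ ≤ ε ∧ ‖y - (embD i (inc i b) + r)‖ ≤ ε := by
  obtain ⟨q, hq, hyq⟩ := Metric.mem_closure_iff.1 hy ε hε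
  obtain ⟨z, ⟨b, hbz⟩, R, hR, hsum⟩ :=
    Submodule.mem_sup.1 (span_wordProd_le i (adjoin_le_span_wordProd hA.unital hq))
  have h1 : q.1 = embA i b + R.1 := by rw [← hsum, ← hbz]; rfl
  have h2 : q.2 = embD i (inc i b) + R.2 := by rw [← hsum, ← hbz]; rfl
  rw [Prod.dist_eq, max_lt_iff, dist_zero_left, dist_eq_norm, h1, h2] at hyq
  have hR1 : R.1 ∈ Submodule.span ℂ
      (offWords (fun i => (φ i).comp (inc i).toAlgHom.toLinearMap) embA i) :=
    map_mem_span_offWords (StarAlgHom.fst ℂ CA CD) (fun _ _ => rfl) hR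
  have hR2 : R.2 ∈ Submodule.span ℂ
      (offWords (fun i => (φ i).comp (inc i).toAlgHom.toLinearMap)
        (fun i => (embD i).comp (inc i)) i) :=
    map_mem_span_offWords (StarAlgHom.snd ℂ CA CD) (fun _ _ => rfl) hR
  have hb := hA.norm_le_norm_add hEA hφ hfaith hres b hR1
  exact ⟨b, R.2, hR2, hb.trans hyq.1.le, hyq.2.le⟩

lemma apply_wordProd_eq_zero
    (hA : IsFreeFamily (fun i => (φ i).comp (inc i).toAlgHom.toLinearMap) embA EA)
    (hD : IsFreeFamily φ embD ED) (hEA : IsState EA) (hED : IsState ED)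
    (hφ : ∀ i, IsState (φ i))
    (hfaith : ∀ i, FaithfulGNS ((φ i).comp (inc i).toAlgHom.toLinearMap))
    (hres : ∀ i a, EA (embA i a) = φ i (inc i a))
    {H : Type*} [NormedAddCommGroup H] [InnerProductSpace ℂ H] [CompleteSpace H]
    {ρ : CD →⋆ₐ[ℂ] (H →L[ℂ] H)} {Λ : CD →ₗ[ℂ] H} (hΛ : IsGNSRep ED ρ Λ)
    {w : List (Σ i, D i)} (hw : IsReducedWord φ w) {y : CD}
    (hy : (0, y) ∈ freeProdGraph inc embA embD) : ρ y (Λ (wordProd embD w)) = 0 := by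
  have hsq : ∀ {y : CD}, (0, y) ∈ freeProdGraph inc embA embD →
      (0, star y * y) ∈ freeProdGraph inc embA embD := fun hy => by
    simpa [Prod.star_def] using mul_mem (star_mem hy) hy
  induction w generalizing y with
  | nil =>
    rw [wordProd_nil, hΛ.apply_eq, mul_one, ← inner_self_eq_zero (𝕜 := ℂ), hΛ.inner_eq]
    simpa using (apply_fst_eq_apply_snd hA hD hEA.continuous hED.continuous (hsq hy)).symm
  | cons s w ih =>
    obtain ⟨i, d⟩ := s
    obtain ⟨-, hwi, hw⟩ := isReducedWord_cons.1 hw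
    set LD : D i →ₗ[ℂ] H :=
      Λ ∘ₗ LinearMap.mulRight ℂ (wordProd embD w) ∘ₗ (embD i).toAlgHom.toLinearMap
    set LA : A i →ₗ[ℂ] H := LD ∘ₗ (inc i).toAlgHom.toLinearMap
    set K := LA.range.topologicalClosure with hK
    have hKD : K ≤ LD.range.topologicalClosure :=
      Submodule.topologicalClosure_mono (LinearMap.range_comp_le_range _ _)
    rw [wordProd_cons]
    change ρ y (LD d) = 0
    set u := K.starProjection (LD d)
    set v := LD d - u
    have huK : u ∈ K := K.starProjection_apply_mem _
    have hvK : v ∈ Kᗮ := K.sub_starProjection_mem_orthogonal _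
    have hvD : v ∈ LD.range.topologicalClosure :=
      sub_mem (Submodule.le_topologicalClosure _ ⟨d, rfl⟩) (hKD huK)
    have hu : ρ y u = 0 := by
      refine closure_minimal (t := {u | ρ y u = 0}) ?_ (isClosed_eq (by fun_prop) (by fun_prop))
        huK
      rintro _ ⟨a, rfl⟩
      have := ih hw (y := y * embD i (inc i a)) (by
        simpa using mul_mem hy (mem_freeProdGraph (embA := embA) (embD := embD) i a))
      rwa [hΛ.apply_eq, mul_assoc, ← hΛ.apply_eq] at this
    have hvA : ∀ a : A i, inner ℂ (Λ (embD i (inc i a) * wordProd embD w)) v = 0 := fun a =>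
      hvK _ (Submodule.le_topologicalClosure _ ⟨a, rfl⟩)
    have hdiag : ∀ c, (0, c) ∈ freeProdGraph inc embA embD → inner ℂ v (ρ c v) = 0 := by
      intro c hc
      have hbound : ∀ {x : CD}, ‖inner ℂ v (ρ x v)‖ ≤ ‖x‖ * (‖v‖ * ‖v‖) := fun {x} =>
        calc ‖inner ℂ v (ρ x v)‖ ≤ ‖v‖ * ‖ρ x v‖ := norm_inner_le_norm _ _
          _ ≤ ‖v‖ * (‖x‖ * ‖v‖) := by
            gcongr
            exact (ρ x).le_of_opNorm_le (NonUnitalStarAlgHom.norm_apply_le ρ x) _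
          _ = _ := by ring
      have hsmall : ∀ ε > 0, ‖inner ℂ v (ρ c v)‖ ≤ ε * (2 * (‖v‖ * ‖v‖)) := by
        intro ε hε
        obtain ⟨b, r, hr, hb, hcb⟩ :=
          exists_add_offWords_near hA hEA ((hφ i).comp (inc i)) (hfaith i) (hres i) hc hε
        have h0 : inner ℂ v (ρ r v) = 0 :=
          hD.inner_offWords_eq_zero (fun i => (hφ i).apply_star) hΛ hw hwi hvD hvA hr
        have hb' : ‖embD i (inc i b)‖ ≤ ε :=
          (NonUnitalStarAlgHom.norm_apply_le ((embD i).comp (inc i)) b).trans hb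
        have hsplit : inner ℂ v (ρ c v) = inner ℂ v (ρ (c - (embD i (inc i b) + r)) v) +
            inner ℂ v (ρ (embD i (inc i b)) v) := by
          simp only [map_sub, map_add, sub_apply, add_apply, inner_sub_right, inner_add_right, h0]
          ring
        rw [hsplit]
        calc _ ≤ ε * (‖v‖ * ‖v‖) + ε * (‖v‖ * ‖v‖) :=
              norm_add_le_of_le (hbound.trans (by gcongr)) (hbound.trans (by gcongr))
          _ = _ := by ring
      rw [← norm_le_zero_iff]
      refine le_of_forall_pos_le_add fun ε hε => ?_
      refine (hsmall (ε / (2 * (‖v‖ * ‖v‖) + 1)) (by positivity)).trans ?_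
      rw [zero_add, div_mul_eq_mul_div, div_le_iff₀ (by positivity)]
      gcongr
      linarith
    have hv : ρ y v = 0 := by
      rw [← inner_self_eq_zero (𝕜 := ℂ), inner_starAlgHom_apply_left,
        ← mul_apply_eq_comp, ← map_mul]
      exact hdiag _ (hsq hy)
    rw [← sub_add_cancel (LD d) u, map_add, hu, add_zero]
    exact hv

lemma eq_zero_of_zero_mk_mem
    (hA : IsFreeFamily (fun i => (φ i).comp (inc i).toAlgHom.toLinearMap) embA EA)
    (hD : IsFreeFamily φ embD ED) (hEA : IsState EA) (hED : IsState ED)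
    (hφ : ∀ i, IsState (φ i))
    (hfaith : ∀ i, FaithfulGNS ((φ i).comp (inc i).toAlgHom.toLinearMap))
    (hres : ∀ i a, EA (embA i a) = φ i (inc i a)) (hfaithED : FaithfulGNS ED)
    (hgen : Dense ((StarAlgebra.adjoin ℂ (⋃ i, Set.range (embD i)) : StarSubalgebra ℂ CD) :
      Set CD)) {y : CD} (hy : (0, y) ∈ freeProdGraph inc embA embD) : y = 0 := by
  obtain ⟨H, _, _, _, ρ, Λ, hΛ⟩ := hED.exists_isGNSRep
  refine hΛ.eq_zero_of_apply hfaithED fun x => ?_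
  have hcont := hΛ.continuous
  refine closure_minimal (t := {x | ρ y (Λ x) = 0}) (fun x hx => ?_)
    (isClosed_eq (by fun_prop) (by fun_prop)) (hgen x)
  have hle : Submodule.span ℂ {x | ∃ l, IsReducedWord φ l ∧ x = wordProd embD l} ≤
      ((ρ y).toLinearMap ∘ₗ Λ).ker := by
    rw [Submodule.span_le]
    rintro _ ⟨l, hl, rfl⟩
    exact apply_wordProd_eq_zero hA hD hEA hED hφ hfaith hres hΛ hl hy
  exact hle (adjoin_le_span_wordProd hD.unital hx)

end FreeProduct

/-- **Property (UnivProp).**  Let `I` be a set and for every `i ∈ I` let `A i ⊆ D i` be a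
unital inclusion (`inc i`) of unital C⋆-algebras.  Suppose `φ i` is a state on `D i` such
that the GNS representations of `φ i` and of the restriction `φ i ∘ inc i` are both
faithful.  Let `(CD, ED) = *_{i ∈ I}(D i, φ i)` and `(CA, EA) = *_{i ∈ I}(A i, φ i ∘ inc i)`
be the reduced free products of C⋆-algebras (i.e. reduced amalgamated free products over
the scalars `ℂ`).  Then there is a ⋆-homomorphism `π : CA → CD`, necessarily injective,
such that for every `i ∈ I` the restriction of `π` to the canonical copy of `A i` in `CA`
agrees with the composition of the inclusion `A i ⊆ D i` with the canonical embedding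
`D i ↪ CD`. -/
theorem reducedFreeProd_embedding_of_subalgebras
    {I : Type*} (A D : I → Type*) [∀ i, CStarAlgebra (A i)] [∀ i, CStarAlgebra (D i)]
    (inc : ∀ i, A i →⋆ₐ[ℂ] D i) (hinc : ∀ i, Function.Injective (inc i))
    (φ : ∀ i, D i →ₗ[ℂ] ℂ) (hst : ∀ i, IsState (φ i))
    (hfaithD : ∀ i, FaithfulGNS (φ i))
    (hfaithA : ∀ i, FaithfulGNS ((φ i).comp (inc i).toAlgHom.toLinearMap))
    {CD : Type*} [CStarAlgebra CD] (embD : ∀ i, D i →⋆ₐ[ℂ] CD) (ED : CD →ₗ[ℂ] ℂ)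
    (hprodD : IsReducedAmalgProd ℂ (fun i => StarAlgHom.ofId ℂ (D i)) φ
      (StarAlgHom.ofId ℂ CD) embD ED)
    {CA : Type*} [CStarAlgebra CA] (embA : ∀ i, A i →⋆ₐ[ℂ] CA) (EA : CA →ₗ[ℂ] ℂ)
    (hprodA : IsReducedAmalgProd ℂ (fun i => StarAlgHom.ofId ℂ (A i))
      (fun i => (φ i).comp (inc i).toAlgHom.toLinearMap) (StarAlgHom.ofId ℂ CA) embA EA) :
    ∃ π : CA →⋆ₐ[ℂ] CD,
      (∀ i (a : A i), π (embA i a) = embD i (inc i a)) ∧ Function.Injective π := by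
  have hA := hprodA.isFreeFamily
  have hD := hprodD.isFreeFamily
  set G := freeProdGraph inc embA embD
  have hG : IsClosed (G : Set (CA × CD)) := StarSubalgebra.isClosed_topologicalClosure _
  let p₁ : G →⋆ₐ[ℂ] CA := (StarAlgHom.fst ℂ CA CD).comp G.subtype
  let p₂ : G →⋆ₐ[ℂ] CD := (StarAlgHom.snd ℂ CA CD).comp G.subtype
  have hinj₁ : Function.Injective p₁ := by
    refine (injective_iff_map_eq_zero p₁).2 ?_
    rintro ⟨⟨x, y⟩, hxy⟩ h0
    obtain rfl : x = 0 := h0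
    obtain rfl : y = 0 := eq_zero_of_zero_mk_mem hA hD hprodA.condExp hprodD.condExp hst hfaithA
      hprodA.restrict hprodD.faithful hprodD.generating hxy
    rfl
  have hinj₂ : Function.Injective p₂ := by
    refine (injective_iff_map_eq_zero p₂).2 ?_
    rintro ⟨⟨x, y⟩, hxy⟩ h0
    obtain rfl : y = 0 := h0
    obtain rfl : x = 0 := eq_zero_of_mk_zero_mem hA hD hprodA.condExp hprodD.condExp
      hprodA.faithful hprodA.generating hxy
    rfl
  have hsurj₁ : Function.Surjective p₁ := by
    have hclosed : IsClosed (Set.range p₁) :=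
      (NonUnitalStarAlgHom.isometry p₁ hinj₁).isClosedEmbedding.isClosed_range
    intro x
    refine closure_minimal ?_ hclosed
      (dense_fst_freeProdGraph (inc := inc) (embD := embD) hprodA.generating x)
    rintro x ⟨y, hxy⟩
    exact ⟨⟨(x, y), hxy⟩, rfl⟩
  let e : G ≃⋆ₐ[ℂ] CA := StarAlgEquiv.ofBijective p₁ ⟨hinj₁, hsurj₁⟩
  refine ⟨p₂.comp (e.symm : CA →⋆ₐ[ℂ] G), fun i a => ?_, hinj₂.comp e.symm.injective⟩
  have he : e.symm (embA i a) = ⟨(embA i a, embD i (inc i a)), mem_freeProdGraph i a⟩ :=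
    e.symm_apply_eq.2 rfl
  change p₂ (e.symm (embA i a)) = _
  rw [he]
  rfl
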